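/- arXiv:2104.00736 — 3 statements merged into one kernel-verified Lean document; each statement's English description precedes it below -/
import Mathlib

section
/- Completion-of-square identity for the posterior covariance: for every gain matrix K̂ ∈ ℝ^{n×p}, P(K̂) = P(K_KF) + (K̂ − K_KF) · R̄ · (K̂ − K_KF)ᵀ. -/
open Matrix

/-- UKF weight vector `W ∈ ℝ^{2n+1}`. -/
noncomputable def ukfW (n : ℕ) (α : ℝ) : Fin (2*n+1) → ℝ :=
  fun i => if i.val = 0 then (α^2 - 1)/α^2 else 1/(2*α^2*n)

/-- Perturbation matrix `Δ(α, B)`: first column 0, next n columns `α·bᵢ`,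
last n columns `−α·bᵢ`. -/
noncomputable def ukfDelta (n : ℕ) (α : ℝ) (B : Matrix (Fin n) (Fin n) ℝ) :
    Matrix (Fin n) (Fin (2*n+1)) ℝ :=
  Matrix.of fun i j =>
    if h0 : j.val = 0 then 0
    else if h1 : j.val ≤ n then α * B i ⟨j.val - 1, by omega⟩
    else -(α * B i ⟨j.val - n - 1, by have := j.isLt; omega⟩)

/-- Sigma-point matrix `X(x̂, α, B)`: j-th column is `x̂` plus the j-th column of `Δ(α, B)`. -/
noncomputable def sigmaPts {n : ℕ} (xhat : Fin n → ℝ) (α : ℝ)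
    (B : Matrix (Fin n) (Fin n) ℝ) : Matrix (Fin n) (Fin (2*n+1)) ℝ :=
  Matrix.of fun i j => xhat i + ukfDelta n α B i j

/-- Affine propagation of an ensemble: j-th column of the result is `A·(j-th column of X) + u`. -/
noncomputable def propagate {n : ℕ} (A : Matrix (Fin n) (Fin n) ℝ) (u : Fin n → ℝ)
    (X : Matrix (Fin n) (Fin (2*n+1)) ℝ) : Matrix (Fin n) (Fin (2*n+1)) ℝ :=
  Matrix.of fun i j => A.mulVec (fun r => X r j) i + u i

/-- Deviation matrix `X̃ = X − (X·W)·1ᵀ`. -/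
noncomputable def devMat {q m : ℕ} (w : Fin m → ℝ) (X : Matrix (Fin q) (Fin m) ℝ) :
    Matrix (Fin q) (Fin m) ℝ :=
  X - Matrix.vecMulVec (X.mulVec w) (fun _ => 1)

/-- Posterior covariance as a function of the gain:
`P(K̂) = P_prior + K̂·R̄·K̂ᵀ − K̂·C·P_prior − P_prior·Cᵀ·K̂ᵀ`. -/
noncomputable def postCov {n p : ℕ} (Pprior : Matrix (Fin n) (Fin n) ℝ)
    (C : Matrix (Fin p) (Fin n) ℝ) (Rbar : Matrix (Fin p) (Fin p) ℝ)
    (K : Matrix (Fin n) (Fin p) ℝ) : Matrix (Fin n) (Fin n) ℝ :=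
  Pprior + K * Rbar * Kᵀ - K * C * Pprior - Pprior * Cᵀ * Kᵀ

/-- Completion of the square at a gain `K₀` solving the normal equation `K₀ * Rbar = Pprior * Cᵀ`. -/
theorem postCov_eq_add_of_mul_eq {n p : ℕ} {Pprior : Matrix (Fin n) (Fin n) ℝ}
    {C : Matrix (Fin p) (Fin n) ℝ} {Rbar : Matrix (Fin p) (Fin p) ℝ}
    {K₀ : Matrix (Fin n) (Fin p) ℝ} (hP : Ppriorᵀ = Pprior) (hR : Rbarᵀ = Rbar)
    (hK₀ : K₀ * Rbar = Pprior * Cᵀ) (K : Matrix (Fin n) (Fin p) ℝ) :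
    postCov Pprior C Rbar K = postCov Pprior C Rbar K₀ + (K - K₀) * Rbar * (K - K₀)ᵀ := by
  have hK₀T : C * Pprior = Rbar * K₀ᵀ := by
    simpa [hP, hR] using (congrArg transpose hK₀).symm
  simp only [postCov, Matrix.mul_assoc K C, Matrix.mul_assoc K₀ C, hK₀T, ← hK₀, transpose_sub,
    Matrix.sub_mul, Matrix.mul_sub, Matrix.mul_assoc]
  abel

theorem stmt0 {n p : ℕ} (hn : 0 < n) (hp : 0 < p)
    (Pprior : Matrix (Fin n) (Fin n) ℝ) (C : Matrix (Fin p) (Fin n) ℝ)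
    (R : Matrix (Fin p) (Fin p) ℝ)
    (hP : Pprior.PosSemidef) (hR : R.PosDef)
    (Rbar : Matrix (Fin p) (Fin p) ℝ) (hRbar : Rbar = C * Pprior * Cᵀ + R)
    (KKF : Matrix (Fin n) (Fin p) ℝ) (hKKF : KKF = Pprior * Cᵀ * Rbar⁻¹)
    (Khat : Matrix (Fin n) (Fin p) ℝ) :
    postCov Pprior C Rbar Khat =
      postCov Pprior C Rbar KKF + (Khat - KKF) * Rbar * (Khat - KKF)ᵀ := by
  have hPT : Ppriorᵀ = Pprior := by simpa using hP.isHermitian.eq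
  have hpos : Rbar.PosDef := by
    rw [hRbar]
    exact hR.posSemidef_add (by simpa using hP.mul_mul_conjTranspose_same C)
  have hRT : Rbarᵀ = Rbar := by simpa using hpos.isHermitian.eq
  refine postCov_eq_add_of_mul_eq hPT hRT ?_ Khat
  rw [hKKF, Matrix.mul_assoc, nonsing_inv_mul _ ((isUnit_iff_isUnit_det _).mp hpos.isUnit),
    Matrix.mul_one]
end

section
/- The Kalman gain minimizes the trace of the posterior covariance: for every gain matrix K̂ ∈ ℝ^{n×p}, trace(P(K_KF)) ≤ trace(P(K̂)). -/
open Matrix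

/-- Completing the square: the posterior covariance at `K` exceeds the one at a gain `K₀` solving
the normal equations by the quadratic form of `K - K₀`. -/
theorem postCov_eq_add_of_normal_equation {n p : ℕ} {Pprior : Matrix (Fin n) (Fin n) ℝ}
    {C : Matrix (Fin p) (Fin n) ℝ} {Rbar : Matrix (Fin p) (Fin p) ℝ}
    {K₀ : Matrix (Fin n) (Fin p) ℝ} (hP : Ppriorᵀ = Pprior) (hRbar : Rbarᵀ = Rbar)
    (hK₀ : K₀ * Rbar = Pprior * Cᵀ) (K : Matrix (Fin n) (Fin p) ℝ) :
    postCov Pprior C Rbar K = postCov Pprior C Rbar K₀ + (K - K₀) * Rbar * (K - K₀)ᵀ := by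
  have hK₀' : C * Pprior = Rbar * K₀ᵀ := by
    simpa [hP, hRbar] using (congrArg transpose hK₀).symm
  simp only [postCov, ← hK₀, Matrix.mul_assoc, hK₀', transpose_sub, Matrix.mul_sub,
    Matrix.sub_mul]
  abel

theorem stmt1 {n p : ℕ} (hn : 0 < n) (hp : 0 < p)
    (Pprior : Matrix (Fin n) (Fin n) ℝ) (C : Matrix (Fin p) (Fin n) ℝ)
    (R : Matrix (Fin p) (Fin p) ℝ)
    (hP : Pprior.PosSemidef) (hR : R.PosDef)
    (Rbar : Matrix (Fin p) (Fin p) ℝ) (hRbar : Rbar = C * Pprior * Cᵀ + R)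
    (KKF : Matrix (Fin n) (Fin p) ℝ) (hKKF : KKF = Pprior * Cᵀ * Rbar⁻¹)
    (Khat : Matrix (Fin n) (Fin p) ℝ) :
    (postCov Pprior C Rbar KKF).trace ≤ (postCov Pprior C Rbar Khat).trace := by
  have hRbar_pos : Rbar.PosDef := by
    rw [hRbar]
    exact PosDef.posSemidef_add (by simpa using hP.mul_mul_conjTranspose_same C) hR
  have hnormal : KKF * Rbar = Pprior * Cᵀ := by
    rw [hKKF, Matrix.mul_assoc, nonsing_inv_mul _ hRbar_pos.det_pos.ne'.isUnit, Matrix.mul_one]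
  have hP_symm : Ppriorᵀ = Pprior := by simpa using hP.isHermitian.eq
  have hRbar_symm : Rbarᵀ = Rbar := by simpa using hRbar_pos.isHermitian.eq
  have hgap : 0 ≤ ((Khat - KKF) * Rbar * (Khat - KKF)ᵀ).trace := by
    simpa using (hRbar_pos.posSemidef.mul_mul_conjTranspose_same (Khat - KKF)).trace_nonneg
  rw [postCov_eq_add_of_normal_equation hP_symm hRbar_symm hnormal Khat, trace_add]
  exact le_add_of_nonneg_right hgap
end

section
/- For a linear system, the UKF prior covariance equals the Kalman-filter prior covariance: P_prior^UKF = X̃·W_d·X̃ᵀ + Q = A·P·Aᵀ + Q = P_prior. -/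
open Matrix

theorem sum_fin_two_mul_add_one {M : Type*} [AddCommMonoid M] {n : ℕ} (f : Fin (2*n+1) → M) :
    ∑ j, f j = f 0 + (∑ i : Fin n, f ⟨i.val + 1, by omega⟩ +
      ∑ i : Fin n, f ⟨n + i.val + 1, by omega⟩) := by
  rw [Fin.sum_univ_succ, ← Equiv.sum_comp (finCongr (two_mul n).symm), Fin.sum_univ_add]
  rfl

theorem ukfW_zero (n : ℕ) (α : ℝ) : ukfW n α 0 = (α^2 - 1)/α^2 := by
  simp [ukfW]

theorem ukfW_succ (n : ℕ) (α : ℝ) (k : ℕ) (hk : k + 1 < 2*n+1) :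
    ukfW n α ⟨k + 1, hk⟩ = 1/(2*α^2*n) := by
  simp [ukfW]

section

variable {n : ℕ} (α : ℝ) (B : Matrix (Fin n) (Fin n) ℝ) (r : Fin n)

theorem ukfDelta_zero : ukfDelta n α B r 0 = 0 := by
  simp [ukfDelta]

theorem ukfDelta_left (i : Fin n) (hi : i.val + 1 < 2*n+1) :
    ukfDelta n α B r ⟨i.val + 1, hi⟩ = α * B r i := by
  have h : i.val + 1 ≤ n := i.isLt
  simp [ukfDelta, h]

theorem ukfDelta_right (i : Fin n) (hi : n + i.val + 1 < 2*n+1) :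
    ukfDelta n α B r ⟨n + i.val + 1, hi⟩ = -(α * B r i) := by
  have h : ¬ n + i.val + 1 ≤ n := by omega
  have h' : n + i.val + 1 - n - 1 = i.val := by omega
  simp [ukfDelta, h, h']

end

theorem sum_ukfW {n : ℕ} (hn : 0 < n) {α : ℝ} (hα : α ≠ 0) : ∑ j, ukfW n α j = 1 := by
  have hn' : (n : ℝ) ≠ 0 := by exact_mod_cast hn.ne'
  simp only [sum_fin_two_mul_add_one, ukfW_zero, ukfW_succ, Finset.sum_const, Finset.card_univ,
    Fintype.card_fin, nsmul_eq_mul]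
  field_simp
  ring

theorem ukfDelta_mulVec_ukfW {n : ℕ} (α : ℝ) (B : Matrix (Fin n) (Fin n) ℝ) :
    ukfDelta n α B *ᵥ ukfW n α = 0 := by
  ext r
  simp only [mulVec, dotProduct, sum_fin_two_mul_add_one, ukfDelta_zero, ukfDelta_left,
    ukfDelta_right, ukfW_succ, ← Finset.sum_add_distrib]
  simp

theorem ukfDelta_mul_diagonal_mul_transpose {n : ℕ} (hn : 0 < n) {α : ℝ} (hα : α ≠ 0)
    (B : Matrix (Fin n) (Fin n) ℝ) :
    ukfDelta n α B * diagonal (ukfW n α) * (ukfDelta n α B)ᵀ = (n : ℝ)⁻¹ • (B * Bᵀ) := by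
  have hn' : (n : ℝ) ≠ 0 := by exact_mod_cast hn.ne'
  ext r s
  rw [Matrix.mul_apply, Matrix.smul_apply, Matrix.mul_apply, smul_eq_mul, Finset.mul_sum]
  simp only [mul_diagonal, transpose_apply, sum_fin_two_mul_add_one, ukfDelta_zero,
    ukfDelta_left, ukfDelta_right, ukfW_succ, ← Finset.sum_add_distrib, mul_zero, zero_add]
  refine Finset.sum_congr rfl fun i _ => ?_
  field_simp
  ring

theorem propagate_sigmaPts {n : ℕ} (A : Matrix (Fin n) (Fin n) ℝ) (u xhat : Fin n → ℝ) (α : ℝ)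
    (B : Matrix (Fin n) (Fin n) ℝ) :
    propagate A u (sigmaPts xhat α B) =
      vecMulVec (A *ᵥ xhat + u) (fun _ => 1) + A * ukfDelta n α B := by
  ext i j
  simp only [propagate, sigmaPts, of_apply, mulVec, dotProduct, vecMulVec_apply, Matrix.add_apply,
    Matrix.mul_apply, Pi.add_apply, mul_add, Finset.sum_add_distrib]
  ring

theorem devMat_vecMulVec_one_add {q m : ℕ} {w : Fin m → ℝ} (hw : ∑ j, w j = 1) (v : Fin q → ℝ)
    {D : Matrix (Fin q) (Fin m) ℝ} (hD : D *ᵥ w = 0) :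
    devMat w (vecMulVec v (fun _ => 1) + D) = D := by
  have h : vecMulVec v (fun _ => 1) *ᵥ w = v := by
    ext i
    simp [mulVec, dotProduct, vecMulVec_apply, ← Finset.mul_sum, hw]
  rw [devMat, add_mulVec, hD, h, add_zero, add_sub_cancel_left]

theorem stmt8 {n p : ℕ} (hn : 0 < n) (hp : 0 < p)
    (A : Matrix (Fin n) (Fin n) ℝ) (C : Matrix (Fin p) (Fin n) ℝ)
    (Q P : Matrix (Fin n) (Fin n) ℝ) (R : Matrix (Fin p) (Fin p) ℝ)
    (hQ : Q.PosSemidef) (hR : R.PosDef) (hP : P.PosSemidef)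
    (xhat u : Fin n → ℝ) (α : ℝ) (hα : α ≠ 0)
    (B : Matrix (Fin n) (Fin n) ℝ) (hB : B * Bᵀ = (n : ℝ) • P)
    (X' : Matrix (Fin n) (Fin (2*n+1)) ℝ) (hX' : X' = propagate A u (sigmaPts xhat α B))
    (Xt : Matrix (Fin n) (Fin (2*n+1)) ℝ) (hXt : Xt = devMat (ukfW n α) X')
    (Yt : Matrix (Fin p) (Fin (2*n+1)) ℝ) (hYt : Yt = devMat (ukfW n α) (C * X')) :
    Xt * Matrix.diagonal (ukfW n α) * Xtᵀ + Q = A * P * Aᵀ + Q := by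
  have hn' : (n : ℝ) ≠ 0 := by exact_mod_cast hn.ne'
  have hX : Xt = A * ukfDelta n α B := by
    rw [hXt, hX', propagate_sigmaPts]
    refine devMat_vecMulVec_one_add (sum_ukfW hn hα) _ ?_
    rw [← mulVec_mulVec, ukfDelta_mulVec_ukfW, mulVec_zero]
  have hP' : ukfDelta n α B * diagonal (ukfW n α) * (ukfDelta n α B)ᵀ = P := by
    rw [ukfDelta_mul_diagonal_mul_transpose hn hα, hB, inv_smul_smul₀ hn']
  rw [hX, transpose_mul, ← hP']
  simp only [Matrix.mul_assoc]
end
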